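/- Let R be a commutative ring, n ≥ 1, and let A = (a_{ij}) be an n×n matrix over R. In the exterior algebra Λ(R^{2n}) with standard basis vectors e_1,…,e_n,f_1,…,f_n, set ω := Σ_{1≤i,j≤n} a_{ij} e_i ∧ f_j. Then ω^{n-1} = (n-1)! · (-1)^{(n-1)(n-2)/2} · Σ_{1≤i,j≤n} det(A^{(i,j)}) · (e_1∧…∧ê_i∧…∧e_n) ∧ (f_1∧…∧f̂_j∧…∧f_n), where A^{(i,j)} denotes A with row i and column j deleted, and ê_i (resp. f̂_j) means that the factor e_i (resp. f_j) is omitted from the wedge product. -/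

import Mathlib

open ExteriorAlgebra

/-- The basis vector `e i` of `Λ(R^{2n})`: the image under `ι` of the `i`-th standard
basis vector of the first summand of `R^{2n} = R^n ⊕ R^n`. -/
noncomputable def eVec (R : Type*) [CommRing R] (n : ℕ) (i : Fin n) :
    ExteriorAlgebra R ((Fin n ⊕ Fin n) → R) :=
  ι R (Pi.single (Sum.inl i) 1)

/-- The basis vector `f j` of `Λ(R^{2n})`: the image under `ι` of the `j`-th standard
basis vector of the second summand of `R^{2n} = R^n ⊕ R^n`. -/
noncomputable def fVec (R : Type*) [CommRing R] (n : ℕ) (j : Fin n) :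
    ExteriorAlgebra R ((Fin n ⊕ Fin n) → R) :=
  ι R (Pi.single (Sum.inr j) 1)

/-- `e_1 ∧ … ∧ ê_i ∧ … ∧ e_n` : the ordered wedge of all `e_k` with the factor `e_i`
omitted. -/
noncomputable def hatE (R : Type*) [CommRing R] (n : ℕ) (i : Fin n) :
    ExteriorAlgebra R ((Fin n ⊕ Fin n) → R) :=
  (((List.finRange n).filter (fun k => k ≠ i)).map (eVec R n)).prod

/-- `f_1 ∧ … ∧ f̂_j ∧ … ∧ f_n` : the ordered wedge of all `f_l` with the factor `f_j`
omitted. -/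
noncomputable def hatF (R : Type*) [CommRing R] (n : ℕ) (j : Fin n) :
    ExteriorAlgebra R ((Fin n ⊕ Fin n) → R) :=
  (((List.finRange n).filter (fun l => l ≠ j)).map (fVec R n)).prod

theorem aux_sum_inj {M : Type*} [AddCommMonoid M] (n : ℕ)
    (Φ : (Fin n → Fin (n + 1)) → M) (h : ∀ p, ¬ Function.Injective p → Φ p = 0) :
    ∑ p, Φ p = ∑ i : Fin (n + 1), ∑ σ : Equiv.Perm (Fin n), Φ (i.succAbove ∘ σ) := by
  classical
  rw [← Fintype.sum_prod_type' (f := fun (i : Fin (n + 1)) (σ : Equiv.Perm (Fin n)) =>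
    Φ (i.succAbove ∘ σ))]
  symm
  refine Finset.sum_of_injOn (fun x : Fin (n + 1) × Equiv.Perm (Fin n) => x.1.succAbove ∘ x.2)
    ?_ (by simp) ?_ (by simp)
  · rintro ⟨i, σ⟩ - ⟨j, τ⟩ - hij
    have hij : i.succAbove ∘ σ = j.succAbove ∘ τ := hij
    have e : i = j := by
      have h1 : Set.range (i.succAbove ∘ σ) = Set.range (j.succAbove ∘ τ) := by rw [hij]
      rw [σ.surjective.range_comp, τ.surjective.range_comp, Fin.range_succAbove,
        Fin.range_succAbove] at h1
      simpa using h1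
    subst e
    have : σ = τ := by
      ext k
      have := congrFun hij k
      simp only [Function.comp_apply] at this
      rw [Fin.succAbove_right_injective this]
    rw [this]
  · intro p _ hp
    apply h
    intro hinj
    apply hp
    have hns : ¬ Function.Surjective p := by
      intro hs
      have := Fintype.card_le_of_surjective p hs
      simp at this
    simp only [Function.Surjective, not_forall, not_exists] at hns
    obtain ⟨i, hi⟩ := hns
    have : ∀ k, ∃ l, i.succAbove l = p k := fun k => Fin.exists_succAbove_eq (hi k)
    choose s hs using this
    have hsi : Function.Injective s := by
      intro a b hab
      apply hinj
      rw [← hs, ← hs, hab]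
    refine ⟨(i, Equiv.ofBijective s (Finite.injective_iff_bijective.mp hsi)), by simp, ?_⟩
    funext k
    simp [hs]

theorem aux_filter (n : ℕ) (i : Fin (n + 1)) :
    (List.finRange (n + 1)).filter (fun k => k ≠ i) = List.ofFn i.succAbove := by
  apply List.SortedLT.eq_of_mem_iff
  · exact ((List.sortedLT_finRange _).pairwise.filter _).sortedLT
  · exact (Fin.strictMono_succAbove i).sortedLT_ofFn
  · intro a
    simp [List.mem_ofFn, Fin.exists_succAbove_eq_iff]

theorem aux_comm {R M : Type*} [CommRing R] [AddCommGroup M] [Module R M] (x : M) (m : ℕ)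
    (v : Fin m → M) :
    ι R x * ιMulti R m v = (-1 : R) ^ m • (ιMulti R m v * ι R x) := by
  induction m with
  | zero => simp
  | succ m ih =>
    rw [ιMulti_succ_apply, ← mul_assoc,
      eq_neg_of_add_eq_zero_left (ι_add_mul_swap (R := R) x (v 0)), neg_mul, mul_assoc, ih,
      mul_smul_comm, pow_succ, mul_assoc, mul_neg_one, neg_smul]

theorem aux_pow {R M : Type*} [CommRing R] [AddCommGroup M] [Module R M] {N : ℕ}
    (u g : Fin N → M) (m : ℕ) :
    (∑ i, ι R (u i) * ι R (g i)) ^ m = (-1 : R) ^ (m * (m - 1) / 2) •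
      ∑ p : Fin m → Fin N, ιMulti R m (u ∘ p) * ιMulti R m (g ∘ p) := by
  induction m with
  | zero => simp
  | succ m ih =>
    have hs : (m + 1) * (m + 1 - 1) / 2 = m + m * (m - 1) / 2 := by
      rw [← Finset.sum_range_id_mul_two, ← Finset.sum_range_id_mul_two, Nat.mul_div_cancel _ (by simp),
        Nat.mul_div_cancel _ (by simp), Finset.sum_range_succ, add_comm]
    rw [pow_succ', ih, hs, pow_add, mul_comm ((-1 : R) ^ m), mul_smul, mul_smul_comm]
    congr 1
    rw [← (Fin.consEquiv (fun _ : Fin (m + 1) => Fin N)).sum_comp, Fintype.sum_prod_type,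
      Finset.sum_mul, Finset.smul_sum]
    refine Finset.sum_congr rfl fun i _ => ?_
    rw [Finset.mul_sum, Finset.smul_sum]
    refine Finset.sum_congr rfl fun p _ => ?_
    have h1 : ∀ w : Fin N → M, ιMulti R (m + 1) (w ∘ (Fin.cons i p : Fin (m + 1) → Fin N))
        = ι R (w i) * ιMulti R m (w ∘ p) := by
      intro w
      rw [ιMulti_succ_apply]
      rfl
    change _ = (-1 : R) ^ m • (ιMulti R (m + 1) (u ∘ (Fin.cons i p : Fin (m + 1) → Fin N)) *
      ιMulti R (m + 1) (g ∘ (Fin.cons i p : Fin (m + 1) → Fin N)))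
    rw [h1, h1, mul_assoc, ← mul_assoc (ι R (g i)), aux_comm, smul_mul_assoc, mul_smul_comm]
    simp only [mul_assoc]

theorem aux_pow2 {R M : Type*} [CommRing R] [AddCommGroup M] [Module R M] {n : ℕ}
    (u g : Fin (n + 1) → M) :
    ∑ p : Fin n → Fin (n + 1), ιMulti R n (u ∘ p) * ιMulti R n (g ∘ p) =
      (n.factorial : R) • ∑ i : Fin (n + 1),
        ιMulti R n (u ∘ i.succAbove) * ιMulti R n (g ∘ i.succAbove) := by
  rw [aux_sum_inj, Finset.smul_sum]
  · refine Finset.sum_congr rfl fun i _ => ?_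
    rw [Finset.sum_congr rfl (g := fun _ =>
      ιMulti R n (u ∘ i.succAbove) * ιMulti R n (g ∘ i.succAbove))]
    · simp [Fintype.card_perm, Nat.cast_smul_eq_nsmul]
    · intro σ _
      rw [← Function.comp_assoc, ← Function.comp_assoc, AlternatingMap.map_perm,
        AlternatingMap.map_perm]
      rcases Int.units_eq_one_or (Equiv.Perm.sign σ) with h | h <;> simp [h]
  · intro p hp
    rw [ιMulti_eq_zero_of_not_inj, zero_mul]
    exact fun h => hp (Function.Injective.of_comp h)

theorem aux_det {R M : Type*} [CommRing R] [AddCommGroup M] [Module R M] {n : ℕ}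
    (B : Matrix (Fin n) (Fin (n + 1)) R) (w : Fin (n + 1) → M) :
    ιMulti R n (fun k => ∑ j, B k j • w j) =
      ∑ j : Fin (n + 1), (B.submatrix id j.succAbove).det • ιMulti R n (w ∘ j.succAbove) := by
  have h := (ιMulti R n (M := M)).toMultilinearMap.map_sum (fun k j => B k j • w j)
  simp only [AlternatingMap.coe_multilinearMap] at h
  rw [h]
  have h2 : ∀ p : Fin n → Fin (n + 1), ιMulti R n (fun k => B k (p k) • w (p k)) =
      (∏ k, B k (p k)) • ιMulti R n (w ∘ p) := fun p =>
    (ιMulti R n (M := M)).toMultilinearMap.map_smul_univ _ _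
  simp only [h2]
  rw [aux_sum_inj]
  · refine Finset.sum_congr rfl fun j _ => ?_
    rw [← Matrix.det_transpose, Matrix.det_apply, Finset.sum_smul]
    refine Finset.sum_congr rfl fun σ _ => ?_
    rw [← Function.comp_assoc, AlternatingMap.map_perm]
    rcases Int.units_eq_one_or (Equiv.Perm.sign σ) with h | h <;> simp [h]
  · intro p hp
    rw [ιMulti_eq_zero_of_not_inj, smul_zero]
    exact fun h => hp (Function.Injective.of_comp h)

theorem aux_hatE (R : Type*) [CommRing R] (n : ℕ) (i : Fin (n + 1)) :
    hatE R (n + 1) i = ιMulti R n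
      ((fun k => (Pi.single (Sum.inl k) 1 : (Fin (n + 1) ⊕ Fin (n + 1)) → R)) ∘ i.succAbove) := by
  rw [hatE, aux_filter, List.map_ofFn, ιMulti_apply]
  rfl

theorem aux_hatF (R : Type*) [CommRing R] (n : ℕ) (i : Fin (n + 1)) :
    hatF R (n + 1) i = ιMulti R n
      ((fun k => (Pi.single (Sum.inr k) 1 : (Fin (n + 1) ⊕ Fin (n + 1)) → R)) ∘ i.succAbove) := by
  rw [hatF, aux_filter, List.map_ofFn, ιMulti_apply]
  rfl

/-- Let `R` be a commutative ring and `A` an `(n+1) × (n+1)` matrix over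
`R` (so the size is `≥ 1`).  In `Λ(R^{2(n+1)})`, with `ω := Σ_{i,j} a_{ij} e_i ∧ f_j`, one
has `ω^n = n! ⬝ (-1)^{n(n-1)/2} ⬝ Σ_{i,j} det(A^{(i,j)}) (e_1∧…∧ê_i∧…) ∧ (f_1∧…∧f̂_j∧…)`,
where `A^{(i,j)}` is `A` with row `i` and column `j` deleted. -/
theorem pow_card_sub_one_of_sum_smul_wedge (R : Type*) [CommRing R] (n : ℕ)
    (A : Matrix (Fin (n + 1)) (Fin (n + 1)) R) :
    (∑ i : Fin (n + 1), ∑ j : Fin (n + 1),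
        A i j • (eVec R (n + 1) i * fVec R (n + 1) j)) ^ n
      = (n.factorial : R) •
          ((-1 : R) ^ (n * (n - 1) / 2)) •
            ∑ i : Fin (n + 1), ∑ j : Fin (n + 1),
              (A.submatrix i.succAbove j.succAbove).det •
                (hatE R (n + 1) i * hatF R (n + 1) j) := by
  have h0 : (∑ i : Fin (n + 1), ∑ j : Fin (n + 1),
        A i j • (eVec R (n + 1) i * fVec R (n + 1) j)) =
      ∑ i, ι R (Pi.single (Sum.inl i) 1 : (Fin (n + 1) ⊕ Fin (n + 1)) → R) *
        ι R (∑ j, A i j • (Pi.single (Sum.inr j) 1 : (Fin (n + 1) ⊕ Fin (n + 1)) → R)) := by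
    simp only [map_sum, map_smul, Finset.mul_sum, mul_smul_comm]
    rfl
  rw [h0, aux_pow (R := R) (fun i => (Pi.single (Sum.inl i) 1 : (Fin (n + 1) ⊕ Fin (n + 1)) → R))
    (fun i => ∑ j, A i j • (Pi.single (Sum.inr j) 1 : (Fin (n + 1) ⊕ Fin (n + 1)) → R)),
    aux_pow2, smul_comm]
  congr 2
  refine Finset.sum_congr rfl fun i _ => ?_
  have h := aux_det (A.submatrix i.succAbove id)
    (fun j => (Pi.single (Sum.inr j) 1 : (Fin (n + 1) ⊕ Fin (n + 1)) → R))
  rw [aux_hatE]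
  simp only [aux_hatF, ← mul_smul_comm, ← Finset.mul_sum]
  congr 1
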